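/- arXiv:1812.07766 — 3 statements merged into one kernel-verified Lean document; each statement's English description precedes it below -/
import Mathlib

section
/- Along any T²-symmetric Einstein flow, the quantities A(τ) := ∫_{S¹} e^ρ (V_τ − e^{2(V−τ)} Q_τ Q) dθ and B(τ) := ∫_{S¹} e^{ρ+2(V−τ)} Q_τ dθ are conserved: dA/dτ = 0 and dB/dτ = 0 for all τ. -/
noncomputable section

open Real MeasureTheory intervalIntegral

/-- The θ-mean of a function on the circle of circumference 1 (total measure 1). -/
def circleMean (f : ℝ → ℝ) : ℝ := ∫ θ in (0:ℝ)..1, f θ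

/-- The smooth, θ-periodic fields `V, Q, ρ, l` of a T²-symmetric spacetime in areal
coordinates; first argument is `τ`, second is `θ`. -/
structure T2Flow where
  V : ℝ → ℝ → ℝ
  Q : ℝ → ℝ → ℝ
  ρ : ℝ → ℝ → ℝ
  l : ℝ → ℝ → ℝ
  smooth_V : ContDiff ℝ (⊤ : ℕ∞) (Function.uncurry V)
  smooth_Q : ContDiff ℝ (⊤ : ℕ∞) (Function.uncurry Q)
  smooth_ρ : ContDiff ℝ (⊤ : ℕ∞) (Function.uncurry ρ)
  smooth_l : ContDiff ℝ (⊤ : ℕ∞) (Function.uncurry l)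
  periodic_V : ∀ τ, Function.Periodic (V τ) 1
  periodic_Q : ∀ τ, Function.Periodic (Q τ) 1
  periodic_ρ : ∀ τ, Function.Periodic (ρ τ) 1
  periodic_l : ∀ τ, Function.Periodic (l τ) 1

namespace T2Flow

/-- `V_τ`. -/
def Vτ (F : T2Flow) (τ θ : ℝ) : ℝ := deriv (fun s => F.V s θ) τ
/-- `V_θ`. -/
def Vθ (F : T2Flow) (τ θ : ℝ) : ℝ := deriv (fun x => F.V τ x) θ
/-- `Q_τ`. -/
def Qτ (F : T2Flow) (τ θ : ℝ) : ℝ := deriv (fun s => F.Q s θ) τ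
/-- `Q_θ`. -/
def Qθ (F : T2Flow) (τ θ : ℝ) : ℝ := deriv (fun x => F.Q τ x) θ
/-- `ρ_τ`. -/
def ρτ (F : T2Flow) (τ θ : ℝ) : ℝ := deriv (fun s => F.ρ s θ) τ
/-- `l_τ`. -/
def lτ (F : T2Flow) (τ θ : ℝ) : ℝ := deriv (fun s => F.l s θ) τ
/-- `l_θ`. -/
def lθ (F : T2Flow) (τ θ : ℝ) : ℝ := deriv (fun x => F.l τ x) θ

/-- The energy density
`J = (1/2)[V_τ² + e^{2(τ−ρ)}V_θ² + e^{2(V−τ)}(Q_τ² + e^{2(τ−ρ)}Q_θ²)]`. -/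
def J (F : T2Flow) (τ θ : ℝ) : ℝ :=
  (1/2) * (F.Vτ τ θ ^ 2 + exp (2*(τ - F.ρ τ θ)) * F.Vθ τ θ ^ 2
    + exp (2*(F.V τ θ - τ)) * (F.Qτ τ θ ^ 2 + exp (2*(τ - F.ρ τ θ)) * F.Qθ τ θ ^ 2))

/-- The T²-symmetric vacuum Einstein evolution equations together with the
momentum constraint. -/
def IsEinsteinFlow (F : T2Flow) : Prop :=
  (∀ τ θ : ℝ, deriv (fun s => exp (F.ρ s θ) * F.Vτ s θ) τ
      = deriv (fun x => exp (2*τ - F.ρ τ x) * F.Vθ τ x) θ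
        + exp (2*(F.V τ θ - τ) + F.ρ τ θ)
          * (F.Qτ τ θ ^ 2 - exp (2*(τ - F.ρ τ θ)) * F.Qθ τ θ ^ 2)) ∧
  (∀ τ θ : ℝ, deriv (fun s => exp (F.ρ s θ + 2*(F.V s θ - s)) * F.Qτ s θ) τ
      = deriv (fun x => exp (-F.ρ τ x + 2*F.V τ x) * F.Qθ τ x) θ) ∧
  (∀ τ θ : ℝ, F.lτ τ θ + F.ρτ τ θ + 2 = F.J τ θ) ∧
  (∀ τ θ : ℝ, F.ρτ τ θ = exp (F.l τ θ)) ∧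
  (∀ τ θ : ℝ, F.lθ τ θ = F.Vθ τ θ * F.Vτ τ θ
      + exp (2*(F.V τ θ - τ)) * F.Qθ τ θ * F.Qτ τ θ)

/-- The conserved quantity `A = ∫ e^ρ (V_τ − e^{2(V−τ)} Q_τ Q) dθ`. -/
def A (F : T2Flow) (τ : ℝ) : ℝ :=
  ∫ θ in (0:ℝ)..1,
    exp (F.ρ τ θ) * (F.Vτ τ θ - exp (2*(F.V τ θ - τ)) * F.Qτ τ θ * F.Q τ θ)

/-- The conserved quantity `B = ∫ e^{ρ+2(V−τ)} Q_τ dθ`. -/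
def B (F : T2Flow) (τ : ℝ) : ℝ :=
  ∫ θ in (0:ℝ)..1, exp (F.ρ τ θ + 2*(F.V τ θ - τ)) * F.Qτ τ θ

/-- The energy `E = ∫ e^{ρ−2τ} J dθ`. -/
def E (F : T2Flow) (τ : ℝ) : ℝ := ∫ θ in (0:ℝ)..1, exp (F.ρ τ θ - 2*τ) * F.J τ θ

/-- The `S¹`-volume `Π = ⟨e^ρ⟩`. -/
def Pi (F : T2Flow) (τ : ℝ) : ℝ := ∫ θ in (0:ℝ)..1, exp (F.ρ τ θ)

/-- The correction `Λ = (1/2) e^{−2τ} ∫ V_τ (V − ⟨V⟩ − 1) e^ρ dθ`. -/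
def Λ (F : T2Flow) (τ : ℝ) : ℝ :=
  (1/2) * exp (-2*τ) *
    ∫ θ in (0:ℝ)..1, F.Vτ τ θ * (F.V τ θ - circleMean (F.V τ) - 1) * exp (F.ρ τ θ)

/-- The corrected, normalized energy `H = Π (E + Λ)`. -/
def H (F : T2Flow) (τ : ℝ) : ℝ := F.Pi τ * (F.E τ + F.Λ τ)

/-- The twist potential `Y = ⟨e^{l+ρ+2τ}⟩`. -/
def Y (F : T2Flow) (τ : ℝ) : ℝ := ∫ θ in (0:ℝ)..1, exp (F.l τ θ + F.ρ τ θ + 2*τ)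

/-- The error term `Ω = ⟨e^{l+ρ+2τ} J⟩ − e^{2τ} E Y Π⁻¹`. -/
def Ω (F : T2Flow) (τ : ℝ) : ℝ :=
  (∫ θ in (0:ℝ)..1, exp (F.l τ θ + F.ρ τ θ + 2*τ) * F.J τ θ)
    - exp (2*τ) * F.E τ * F.Y τ / F.Pi τ

end T2Flow

/-- The partial derivative in the first variable of a smooth function is smooth. -/
lemma ContDiff.uncurry_deriv_left {f : ℝ → ℝ → ℝ}
    (hf : ContDiff ℝ (⊤ : ℕ∞) (Function.uncurry f)) :
    ContDiff ℝ (⊤ : ℕ∞) (Function.uncurry fun s x => deriv (fun t => f t x) s) := by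
  have hfd : ContDiff ℝ (⊤ : ℕ∞) (fderiv ℝ (Function.uncurry f)) :=
    hf.fderiv_right (by simp)
  convert hfd.clm_apply (contDiff_const (c := ((1 : ℝ), (0 : ℝ)))) using 1
  ext p
  have h : HasFDerivAt (Function.uncurry f) (fderiv ℝ (Function.uncurry f) p) (p.1, p.2) :=
    (hf.differentiable (by simp) p).hasFDerivAt
  exact (h.comp_hasDerivAt p.1 ((hasDerivAt_id p.1).prodMk (hasDerivAt_const p.1 p.2))).deriv

/-- The partial derivative in the second variable of a smooth function is smooth. -/
lemma ContDiff.uncurry_deriv_right {f : ℝ → ℝ → ℝ}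
    (hf : ContDiff ℝ (⊤ : ℕ∞) (Function.uncurry f)) :
    ContDiff ℝ (⊤ : ℕ∞) (Function.uncurry fun s x => deriv (fun y => f s y) x) := by
  have hswap : ContDiff ℝ (⊤ : ℕ∞) (Function.uncurry fun x s => f s x) :=
    hf.comp (contDiff_snd.prodMk contDiff_fst)
  exact hswap.uncurry_deriv_left.comp (contDiff_snd.prodMk contDiff_fst)

/-- Differentiation under the integral sign for smooth functions on a compact interval. -/
lemma hasDerivAt_intervalIntegral_of_contDiff {f : ℝ → ℝ → ℝ}
    (hf : ContDiff ℝ (⊤ : ℕ∞) (Function.uncurry f)) (a b τ : ℝ) :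
    HasDerivAt (fun s => ∫ x in a..b, f s x) (∫ x in a..b, deriv (fun t => f t x) τ) τ := by
  have hf' : Continuous (Function.uncurry fun s x => deriv (fun t => f t x) s) :=
    hf.uncurry_deriv_left.continuous
  have hslice (s : ℝ) : Continuous (f s) := hf.continuous.comp (Continuous.prodMk_right s)
  obtain ⟨C, hC⟩ := ((isCompact_closedBall τ 1).prod (isCompact_uIcc (a := a) (b := b)))
    |>.exists_bound_of_continuousOn hf'.continuousOn
  refine (intervalIntegral.hasDerivAt_integral_of_dominated_loc_of_deriv_le
    (F' := fun s x => deriv (fun t => f t x) s) (bound := fun _ => C)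
    (Metric.closedBall_mem_nhds τ one_pos)
    (.of_forall fun s => (hslice s).aestronglyMeasurable) ((hslice τ).intervalIntegrable a b)
    (hf'.comp (Continuous.prodMk_right τ)).aestronglyMeasurable
    (.of_forall fun x hx s hs => hC (s, x) ⟨hs, Set.uIoc_subset_uIcc hx⟩)
    intervalIntegrable_const (.of_forall fun x _ s _ => ?_)).2
  have hx : Differentiable ℝ fun t => f t x :=
    (hf.comp (contDiff_prodMk_left x)).differentiable (by simp)
  exact (hx s).hasDerivAt

/-- The integral over a period of the density of a conservation law with periodic flux has
vanishing derivative. -/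
lemma deriv_intervalIntegral_eq_zero_of_conservation_law {f : ℝ → ℝ → ℝ} {g : ℝ → ℝ} {τ T : ℝ}
    (hf : ContDiff ℝ (⊤ : ℕ∞) (Function.uncurry f)) (hg : Differentiable ℝ g)
    (hper : Function.Periodic g T) (h : ∀ x, deriv (fun s => f s x) τ = deriv g x) :
    deriv (fun s => ∫ x in (0 : ℝ)..T, f s x) τ = 0 := by
  have hcont : Continuous (deriv g) := by
    rw [← funext h]
    exact hf.uncurry_deriv_left.continuous.comp (Continuous.prodMk_right τ)
  rw [(hasDerivAt_intervalIntegral_of_contDiff hf 0 T τ).deriv,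
    intervalIntegral.integral_congr fun x _ => h x,
    intervalIntegral.integral_deriv_eq_sub (fun x _ => hg x) (hcont.intervalIntegrable 0 T),
    hper.eq, sub_self]

lemma Function.Periodic.periodic_deriv {f : ℝ → ℝ} {T : ℝ} (hf : Function.Periodic f T) :
    Function.Periodic (deriv f) T := fun x => by
  rw [← deriv_comp_add_const, hf.funext]

/-- Along any T²-symmetric Einstein flow, the quantities `A` and `B` are conserved:
`dA/dτ = 0` and `dB/dτ = 0` for all `τ`. -/
theorem conserved_quantities (F : T2Flow) (hF : F.IsEinsteinFlow) :
    ∀ τ : ℝ, deriv F.A τ = 0 ∧ deriv F.B τ = 0 := by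
  intro τ
  obtain ⟨hV, hQ, -⟩ := hF
  have sV := F.smooth_V
  have sQ := F.smooth_Q
  have sρ := F.smooth_ρ
  have sVτ : ContDiff ℝ (⊤ : ℕ∞) (Function.uncurry F.Vτ) := sV.uncurry_deriv_left
  have sQτ : ContDiff ℝ (⊤ : ℕ∞) (Function.uncurry F.Qτ) := sQ.uncurry_deriv_left
  have sVθ : ContDiff ℝ (⊤ : ℕ∞) (Function.uncurry F.Vθ) := sV.uncurry_deriv_right
  have sQθ : ContDiff ℝ (⊤ : ℕ∞) (Function.uncurry F.Qθ) := sQ.uncurry_deriv_right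
  have slice_τ {f : ℝ → ℝ → ℝ} (hf : ContDiff ℝ (⊤ : ℕ∞) (Function.uncurry f)) (x : ℝ) :
      Differentiable ℝ fun s => f s x :=
    (hf.comp (contDiff_prodMk_left x)).differentiable (by simp)
  have slice_θ {f : ℝ → ℝ → ℝ} (hf : ContDiff ℝ (⊤ : ℕ∞) (Function.uncurry f)) (s : ℝ) :
      Differentiable ℝ fun x => f s x :=
    (hf.comp (contDiff_prodMk_right s)).differentiable (by simp)
  have sP : ContDiff ℝ (⊤ : ℕ∞) (Function.uncurry fun s x => exp (F.ρ s x) * F.Vτ s x) :=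
    sρ.exp.mul sVτ
  have sR : ContDiff ℝ (⊤ : ℕ∞)
      (Function.uncurry fun s x => exp (F.ρ s x + 2 * (F.V s x - s)) * F.Qτ s x) :=
    (sρ.add (contDiff_const.mul (sV.sub contDiff_fst))).exp.mul sQτ
  have dρ := slice_θ sρ τ
  have dV := slice_θ sV τ
  have dQ := slice_θ sQ τ
  have dVθ := slice_θ sVθ τ
  have dQθ := slice_θ sQθ τ
  have pV := F.periodic_V τ
  have pQ := F.periodic_Q τ
  have pρ := F.periodic_ρ τ
  have pVθ : Function.Periodic (F.Vθ τ) 1 := pV.periodic_deriv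
  have pQθ : Function.Periodic (F.Qθ τ) 1 := pQ.periodic_deriv
  have dflux : Differentiable ℝ fun x => exp (-F.ρ τ x + 2 * F.V τ x) * F.Qθ τ x := by fun_prop
  have dfluxV : Differentiable ℝ fun x => exp (2 * τ - F.ρ τ x) * F.Vθ τ x := by fun_prop
  constructor
  · have hA : F.A = fun s => ∫ x in (0 : ℝ)..1, (exp (F.ρ s x) * F.Vτ s x
        - exp (F.ρ s x + 2 * (F.V s x - s)) * F.Qτ s x * F.Q s x) := by
      ext s
      refine intervalIntegral.integral_congr fun x _ => ?_
      simp only [exp_add]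
      ring
    rw [hA]
    refine deriv_intervalIntegral_eq_zero_of_conservation_law (g := fun x =>
      exp (2 * τ - F.ρ τ x) * F.Vθ τ x - exp (-F.ρ τ x + 2 * F.V τ x) * F.Qθ τ x * F.Q τ x)
      (sP.sub (sR.mul sQ)) (dfluxV.sub (dflux.mul dQ)) (fun x => ?_) (fun x => ?_)
    · simp only [pV x, pQ x, pρ x, pVθ x, pQθ x]
    · rw [deriv_fun_sub (slice_τ sP x τ) ((slice_τ sR x τ).fun_mul (slice_τ sQ x τ)),
        deriv_fun_mul (slice_τ sR x τ) (slice_τ sQ x τ), hV, hQ,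
        deriv_fun_sub (dfluxV x) ((dflux x).fun_mul (dQ x)), deriv_fun_mul (dflux x) (dQ x)]
      change _ - (_ + _ * F.Qτ τ x) = _ - (_ + _ * F.Qθ τ x)
      have e₁ : exp (2 * (F.V τ x - τ) + F.ρ τ x) * exp (2 * (τ - F.ρ τ x))
          = exp (-F.ρ τ x + 2 * F.V τ x) := by
        rw [← exp_add]
        ring_nf
      rw [← e₁, add_comm (F.ρ τ x)]
      ring
  · exact deriv_intervalIntegral_eq_zero_of_conservation_law sR dflux
      (fun x => by simp only [pV x, pρ x, pQθ x]) (hQ τ)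
end
end

section
/- Along any T²-symmetric Einstein flow, the energy E satisfies the identity E_τ(τ) = ∫_{S¹} [ −ρ_τ e^{ρ−2τ} J − e^{ρ−2τ} V_τ² − e^{2(V−τ)−ρ} Q_θ² ] dθ for all τ. -/
noncomputable section

open Real MeasureTheory intervalIntegral

/-- The `τ`-slices of a smooth function of two variables are differentiable. -/
theorem hasDerivAt_fst_of_contDiff {f : ℝ → ℝ → ℝ} (hf : ContDiff ℝ (⊤ : ℕ∞) (Function.uncurry f))
    (t x : ℝ) :
    HasDerivAt (fun s => f s x) (fderiv ℝ (Function.uncurry f) (t, x) (1, 0)) t := by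
  have h : HasFDerivAt (Function.uncurry f) (fderiv ℝ (Function.uncurry f) (t, x)) (t, x) :=
    (hf.differentiable (by simp)).differentiableAt.hasFDerivAt
  exact h.comp_hasDerivAt t ((hasDerivAt_id t).prodMk (hasDerivAt_const t x))

/-- The `θ`-slices of a smooth function of two variables are differentiable. -/
theorem hasDerivAt_snd_of_contDiff {f : ℝ → ℝ → ℝ} (hf : ContDiff ℝ (⊤ : ℕ∞) (Function.uncurry f))
    (t x : ℝ) :
    HasDerivAt (fun y => f t y) (fderiv ℝ (Function.uncurry f) (t, x) (0, 1)) x := by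
  have h : HasFDerivAt (Function.uncurry f) (fderiv ℝ (Function.uncurry f) (t, x)) (t, x) :=
    (hf.differentiable (by simp)).differentiableAt.hasFDerivAt
  exact h.comp_hasDerivAt x ((hasDerivAt_const x t).prodMk (hasDerivAt_id x))

theorem contDiff_deriv_fst {f : ℝ → ℝ → ℝ} (hf : ContDiff ℝ (⊤ : ℕ∞) (Function.uncurry f)) :
    ContDiff ℝ (⊤ : ℕ∞) (Function.uncurry fun t x => deriv (fun s => f s x) t) := by
  have h : (Function.uncurry fun t x => deriv (fun s => f s x) t)
      = fun p => fderiv ℝ (Function.uncurry f) p (1, 0) :=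
    funext fun p => (hasDerivAt_fst_of_contDiff hf p.1 p.2).deriv
  rw [h]
  exact (hf.fderiv_right (by simp)).clm_apply contDiff_const

theorem contDiff_deriv_snd {f : ℝ → ℝ → ℝ} (hf : ContDiff ℝ (⊤ : ℕ∞) (Function.uncurry f)) :
    ContDiff ℝ (⊤ : ℕ∞) (Function.uncurry fun t x => deriv (fun y => f t y) x) := by
  have h : (Function.uncurry fun t x => deriv (fun y => f t y) x)
      = fun p => fderiv ℝ (Function.uncurry f) p (0, 1) :=
    funext fun p => (hasDerivAt_snd_of_contDiff hf p.1 p.2).deriv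
  rw [h]
  exact (hf.fderiv_right (by simp)).clm_apply contDiff_const

/-- Mixed partial derivatives of a smooth function commute. -/
theorem deriv_fst_deriv_snd_comm {f : ℝ → ℝ → ℝ}
    (hf : ContDiff ℝ (⊤ : ℕ∞) (Function.uncurry f)) (t x : ℝ) :
    deriv (fun s => deriv (fun y => f s y) x) t = deriv (fun y => deriv (fun s => f s y) t) x := by
  have hd : HasFDerivAt (fderiv ℝ (Function.uncurry f))
      (fderiv ℝ (fderiv ℝ (Function.uncurry f)) (t, x)) (t, x) :=
    ((hf.fderiv_right (m := (⊤ : ℕ∞)) (by simp)).differentiable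
      (by simp)).differentiableAt.hasFDerivAt
  have hsymm := (hf.contDiffAt (x := (t, x))).isSymmSndFDerivAt
    (by simpa using WithTop.coe_le_coe.2 (le_top (a := (2 : ℕ∞))))
  simp only [(hasDerivAt_fst_of_contDiff hf _ _).deriv, (hasDerivAt_snd_of_contDiff hf _ _).deriv]
  have h₁ : HasDerivAt (fun s => fderiv ℝ (Function.uncurry f) (s, x) (0, 1))
      (fderiv ℝ (fderiv ℝ (Function.uncurry f)) (t, x) (1, 0) (0, 1)) t :=
    (ContinuousLinearMap.apply ℝ ℝ ((0 : ℝ), (1 : ℝ))).hasFDerivAt.comp_hasDerivAt t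
      (hd.comp_hasDerivAt t ((hasDerivAt_id t).prodMk (hasDerivAt_const t x)))
  have h₂ : HasDerivAt (fun y => fderiv ℝ (Function.uncurry f) (t, y) (1, 0))
      (fderiv ℝ (fderiv ℝ (Function.uncurry f)) (t, x) (0, 1) (1, 0)) x :=
    (ContinuousLinearMap.apply ℝ ℝ ((1 : ℝ), (0 : ℝ))).hasFDerivAt.comp_hasDerivAt x
      (hd.comp_hasDerivAt x ((hasDerivAt_const x t).prodMk (hasDerivAt_id x)))
  rw [h₁.deriv, h₂.deriv, hsymm (1, 0) (0, 1)]

/-- Differentiation under the integral sign for a smooth function of two variables. -/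
theorem hasDerivAt_integral_of_contDiff {f : ℝ → ℝ → ℝ}
    (hf : ContDiff ℝ (⊤ : ℕ∞) (Function.uncurry f)) (a b t : ℝ) :
    HasDerivAt (fun s => ∫ x in a..b, f s x) (∫ x in a..b, deriv (fun s => f s x) t) t := by
  have hc := (contDiff_deriv_fst hf).continuous
  obtain ⟨C, hC⟩ := ((isCompact_closedBall t 1).prod (isCompact_uIcc (a := a) (b := b))
    ).exists_bound_of_continuousOn hc.continuousOn
  refine (intervalIntegral.hasDerivAt_integral_of_dominated_loc_of_deriv_le (bound := fun _ => C)
    (F' := fun t x => deriv (fun s => f s x) t)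
    (Metric.closedBall_mem_nhds t one_pos) ?_ ?_ ?_ ?_ ?_ ?_).2
  · exact .of_forall fun s => (hf.continuous.comp (by fun_prop : Continuous fun x => (s, x))
      ).aestronglyMeasurable
  · exact (hf.continuous.comp (by fun_prop : Continuous fun x => (t, x))).intervalIntegrable _ _
  · exact (hc.comp (by fun_prop : Continuous fun x => (t, x))).aestronglyMeasurable
  · exact .of_forall fun x hx s hs => hC (s, x) ⟨hs, Set.uIoc_subset_uIcc hx⟩
  · exact intervalIntegrable_const
  · exact .of_forall fun x _ s _ =>
      (hasDerivAt_fst_of_contDiff hf s x).differentiableAt.hasDerivAt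

/-- The `θ`-derivative of a periodic function integrates to zero over a period. -/
theorem integral_deriv_snd_eq_zero {f : ℝ → ℝ → ℝ}
    (hf : ContDiff ℝ (⊤ : ℕ∞) (Function.uncurry f)) (t : ℝ) (hp : Function.Periodic (f t) 1) :
    ∫ x in (0:ℝ)..1, deriv (fun y => f t y) x = 0 := by
  rw [integral_eq_sub_of_hasDerivAt
    (fun x _ => (hasDerivAt_snd_of_contDiff hf t x).differentiableAt.hasDerivAt)
    (((contDiff_deriv_snd hf).continuous.comp
      (by fun_prop : Continuous fun x => (t, x))).intervalIntegrable _ _)]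
  simpa using sub_eq_zero.2 (hp 0)

theorem periodic_deriv {g : ℝ → ℝ} {c : ℝ} (hg : Function.Periodic g c) :
    Function.Periodic (deriv g) c := fun x => by
  rw [← deriv_comp_add_const, funext hg]

namespace T2Flow

/-- The energy flux in the `θ`-direction. -/
def flux (F : T2Flow) (τ θ : ℝ) : ℝ :=
  exp (-F.ρ τ θ) * (F.Vθ τ θ * F.Vτ τ θ
    + exp (2*(F.V τ θ - τ)) * F.Qθ τ θ * F.Qτ τ θ)

variable (F : T2Flow)

theorem contDiff_energyDensity : ContDiff ℝ (⊤ : ℕ∞)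
    (Function.uncurry fun τ θ => exp (F.ρ τ θ - 2*τ) * F.J τ θ) := by
  have h₁ := F.smooth_V
  have h₂ := F.smooth_ρ
  have h₃ := contDiff_deriv_fst F.smooth_V
  have h₄ := contDiff_deriv_snd F.smooth_V
  have h₅ := contDiff_deriv_fst F.smooth_Q
  have h₆ := contDiff_deriv_snd F.smooth_Q
  unfold Function.uncurry at *
  unfold J Vτ Vθ Qτ Qθ
  fun_prop

theorem contDiff_flux : ContDiff ℝ (⊤ : ℕ∞) (Function.uncurry F.flux) := by
  have h₁ := F.smooth_V
  have h₂ := F.smooth_ρ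
  have h₃ := contDiff_deriv_fst F.smooth_V
  have h₄ := contDiff_deriv_snd F.smooth_V
  have h₅ := contDiff_deriv_fst F.smooth_Q
  have h₆ := contDiff_deriv_snd F.smooth_Q
  unfold Function.uncurry at *
  unfold flux Vτ Vθ Qτ Qθ
  fun_prop

theorem periodic_flux (τ : ℝ) : Function.Periodic (F.flux τ) 1 := fun θ => by
  have hVτ : F.Vτ τ (θ + 1) = F.Vτ τ θ :=
    congrArg (deriv · τ) (funext fun s => F.periodic_V s θ)
  have hQτ : F.Qτ τ (θ + 1) = F.Qτ τ θ :=
    congrArg (deriv · τ) (funext fun s => F.periodic_Q s θ)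
  have hVθ : F.Vθ τ (θ + 1) = F.Vθ τ θ := periodic_deriv (F.periodic_V τ) θ
  have hQθ : F.Qθ τ (θ + 1) = F.Qθ τ θ := periodic_deriv (F.periodic_Q τ) θ
  simp only [flux, hVτ, hQτ, hVθ, hQθ, F.periodic_V τ θ, F.periodic_ρ τ θ]

/-- The local form of the energy identity. -/
theorem deriv_energyDensity {F : T2Flow} (hF : F.IsEinsteinFlow) (τ θ : ℝ) :
    deriv (fun s => exp (F.ρ s θ - 2*s) * F.J s θ) τ
      = (-(F.ρτ τ θ) * exp (F.ρ τ θ - 2*τ) * F.J τ θ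
        - exp (F.ρ τ θ - 2*τ) * F.Vτ τ θ ^ 2
        - exp (2*(F.V τ θ - τ) - F.ρ τ θ) * F.Qθ τ θ ^ 2)
        + deriv (fun y => F.flux τ y) θ := by
  have hfst : ∀ {f : ℝ → ℝ → ℝ}, ContDiff ℝ (⊤ : ℕ∞) (Function.uncurry f) →
      HasDerivAt (fun s => f s θ) (deriv (fun s => f s θ) τ) τ :=
    fun hf => (hasDerivAt_fst_of_contDiff hf τ θ).differentiableAt.hasDerivAt
  have hsnd : ∀ {f : ℝ → ℝ → ℝ}, ContDiff ℝ (⊤ : ℕ∞) (Function.uncurry f) →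
      HasDerivAt (fun y => f τ y) (deriv (fun y => f τ y) θ) θ :=
    fun hf => (hasDerivAt_snd_of_contDiff hf τ θ).differentiableAt.hasDerivAt
  have V₁ : HasDerivAt (fun s => F.V s θ) (F.Vτ τ θ) τ := hfst F.smooth_V
  have V₂ : HasDerivAt (fun y => F.V τ y) (F.Vθ τ θ) θ := hsnd F.smooth_V
  have ρ₁ : HasDerivAt (fun s => F.ρ s θ) (F.ρτ τ θ) τ := hfst F.smooth_ρ
  have ρ₂ := hsnd F.smooth_ρ
  have V₁₁ : HasDerivAt (fun s => F.Vτ s θ) _ τ := hfst (contDiff_deriv_fst F.smooth_V)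
  have V₁₂ : HasDerivAt (fun y => F.Vτ τ y) _ θ := hsnd (contDiff_deriv_fst F.smooth_V)
  have V₂₁ : HasDerivAt (fun s => F.Vθ s θ) (deriv (fun y => F.Vτ τ y) θ) τ :=
    (hfst (contDiff_deriv_snd F.smooth_V)).congr_deriv (deriv_fst_deriv_snd_comm F.smooth_V τ θ)
  have V₂₂ : HasDerivAt (fun y => F.Vθ τ y) _ θ := hsnd (contDiff_deriv_snd F.smooth_V)
  have Q₁₁ : HasDerivAt (fun s => F.Qτ s θ) _ τ := hfst (contDiff_deriv_fst F.smooth_Q)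
  have Q₁₂ : HasDerivAt (fun y => F.Qτ τ y) _ θ := hsnd (contDiff_deriv_fst F.smooth_Q)
  have Q₂₁ : HasDerivAt (fun s => F.Qθ s θ) (deriv (fun y => F.Qτ τ y) θ) τ :=
    (hfst (contDiff_deriv_snd F.smooth_Q)).congr_deriv (deriv_fst_deriv_snd_comm F.smooth_Q τ θ)
  have Q₂₂ : HasDerivAt (fun y => F.Qθ τ y) _ θ := hsnd (contDiff_deriv_snd F.smooth_Q)
  generalize deriv (fun y => F.Vτ τ y) θ = Vm at V₁₂ V₂₁
  generalize deriv (fun y => F.Qτ τ y) θ = Qm at Q₁₂ Q₂₁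
  generalize deriv (fun s => F.Vτ s θ) τ = Vtt at V₁₁
  generalize deriv (fun s => F.Qτ s θ) τ = Qtt at Q₁₁
  generalize deriv (fun y => F.Vθ τ y) θ = Vxx at V₂₂
  generalize deriv (fun y => F.Qθ τ y) θ = Qxx at Q₂₂
  generalize deriv (fun y => F.ρ τ y) θ = ρx at ρ₂
  have I := hasDerivAt_id' τ
  have eq₁ := hF.1 τ θ
  have eq₂ := hF.2.1 τ θ
  rw [(ρ₁.exp.fun_mul V₁₁).deriv, ((ρ₂.const_sub (2*τ)).exp.fun_mul V₂₂).deriv] at eq₁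
  rw [((ρ₁.fun_add ((V₁.fun_sub I).const_mul 2)).exp.fun_mul Q₁₁).deriv,
    ((ρ₂.fun_neg.fun_add (V₂.const_mul 2)).exp.fun_mul Q₂₂).deriv] at eq₂
  have hJ := (((V₁₁.fun_pow 2).fun_add
    (((I.fun_sub ρ₁).const_mul 2).exp.fun_mul (V₂₁.fun_pow 2))).fun_add
    (((V₁.fun_sub I).const_mul 2).exp.fun_mul ((Q₁₁.fun_pow 2).fun_add
      (((I.fun_sub ρ₁).const_mul 2).exp.fun_mul (Q₂₁.fun_pow 2))))).const_mul (1/2)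
  have hE := (ρ₁.fun_sub (I.const_mul 2)).exp.fun_mul hJ
  have hW := ρ₂.fun_neg.exp.fun_mul ((V₂₂.fun_mul V₁₂).fun_add
    ((((V₂.sub_const τ).const_mul 2).exp.fun_mul Q₂₂).fun_mul Q₁₂))
  refine hE.deriv.trans (Eq.trans ?_ (congrArg _ hW.deriv.symm))
  simp only [J, mul_sub, two_mul, exp_add, exp_sub, exp_neg] at eq₁ eq₂ ⊢
  have hρ := exp_pos (F.ρ τ θ)
  have hτ := exp_pos τ
  have hV := exp_pos (F.V τ θ)
  generalize exp (F.ρ τ θ) = r at *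
  generalize exp τ = t at *
  generalize exp (F.V τ θ) = v at *
  linear_combination (norm := (push_cast; field_simp; ring))
    F.Vτ τ θ / t ^ 2 * eq₁ + F.Qτ τ θ / t ^ 2 * eq₂

end T2Flow

/-- Along any T²-symmetric Einstein flow, the energy `E` satisfies
`E_τ = ∫ [−ρ_τ e^{ρ−2τ} J − e^{ρ−2τ} V_τ² − e^{2(V−τ)−ρ} Q_θ²] dθ`. -/
theorem energy_evolution (F : T2Flow) (hF : F.IsEinsteinFlow) (τ : ℝ) :
    deriv F.E τ = ∫ θ in (0:ℝ)..1,
      (-(F.ρτ τ θ) * Real.exp (F.ρ τ θ - 2*τ) * F.J τ θ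
        - Real.exp (F.ρ τ θ - 2*τ) * F.Vτ τ θ ^ 2
        - Real.exp (2*(F.V τ θ - τ) - F.ρ τ θ) * F.Qθ τ θ ^ 2) := by
  have hE := hasDerivAt_integral_of_contDiff F.contDiff_energyDensity 0 1 τ
  have hflux : IntervalIntegrable (fun θ => deriv (fun y => F.flux τ y) θ) volume 0 1 :=
    ((contDiff_deriv_snd F.contDiff_flux).continuous.comp
      (by fun_prop : Continuous fun θ => (τ, θ))).intervalIntegrable _ _
  have hdens : IntervalIntegrable (fun θ => deriv (fun s => exp (F.ρ s θ - 2*s) * F.J s θ) τ)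
      volume 0 1 :=
    ((contDiff_deriv_fst F.contDiff_energyDensity).continuous.comp
      (by fun_prop : Continuous fun θ => (τ, θ))).intervalIntegrable _ _
  calc deriv F.E τ
      = ∫ θ in (0:ℝ)..1, deriv (fun s => exp (F.ρ s θ - 2*s) * F.J s θ) τ := hE.deriv
    _ = ∫ θ in (0:ℝ)..1, (deriv (fun s => exp (F.ρ s θ - 2*s) * F.J s θ) τ
          - deriv (fun y => F.flux τ y) θ) := by
        rw [integral_sub hdens hflux,
          integral_deriv_snd_eq_zero F.contDiff_flux τ (F.periodic_flux τ), sub_zero]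
    _ = _ := integral_congr fun θ _ => by
        simp only [T2Flow.deriv_energyDensity hF, add_sub_cancel_right]
end
end

section
/- Along any T²-symmetric Einstein flow, at every time τ one has sup_{θ ∈ S¹} |V(τ,θ) − ⟨V⟩(τ)| ≲ (Π E)^{1/2}. -/
noncomputable section

open Real MeasureTheory intervalIntegral

open Set in
theorem abs_sub_le_integral_abs_deriv {f : ℝ → ℝ} (hf : ContDiff ℝ 1 f) {x y : ℝ}
    (hx : x ∈ Icc (0 : ℝ) 1) (hy : y ∈ Icc (0 : ℝ) 1) :
    |f y - f x| ≤ ∫ t in (0 : ℝ)..1, |deriv f t| := by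
  have hc : Continuous (deriv f) := hf.continuous_deriv le_rfl
  wlog hxy : x ≤ y generalizing x y
  · rw [abs_sub_comm]
    exact this hy hx (le_of_not_ge hxy)
  rw [← integral_deriv_eq_sub (fun t _ => hf.differentiable one_ne_zero t)
    (hc.intervalIntegrable _ _)]
  exact (abs_integral_le_integral_abs hxy).trans <|
    integral_mono_interval hx.1 hxy hy.2 (ae_of_all _ fun t => abs_nonneg _)
      (hc.abs.intervalIntegrable _ _)

theorem abs_sub_circleMean_le_integral_abs_deriv {f : ℝ → ℝ} (hf : ContDiff ℝ 1 f)
    (hp : Function.Periodic f 1) (x : ℝ) :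
    |f x - circleMean f| ≤ ∫ t in (0 : ℝ)..1, |deriv f t| := by
  have hfract : f x = f (Int.fract x) := by
    rw [← Int.self_sub_floor, ← mul_one (⌊x⌋ : ℝ), hp.sub_int_mul_eq]
  have hy : Int.fract x ∈ Set.Icc (0 : ℝ) 1 := ⟨Int.fract_nonneg x, (Int.fract_lt_one x).le⟩
  rw [hfract]
  set y := Int.fract x
  have hmean : f y - circleMean f = ∫ t in (0 : ℝ)..1, (f y - f t) := by
    rw [intervalIntegral.integral_sub (by simp) (hf.continuous.intervalIntegrable _ _)]
    simp [circleMean]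
  have hbound := norm_integral_le_of_norm_le_const (a := 0) (b := 1) (f := fun t => f y - f t)
    (C := ∫ t in (0 : ℝ)..1, |deriv f t|) fun t ht =>
      abs_sub_le_integral_abs_deriv hf
        (Set.Ioc_subset_Icc_self (by simpa [Set.uIoc_of_le] using ht)) hy
  rw [hmean]
  simpa using hbound

/-- A form of the Cauchy–Schwarz inequality for continuous functions. -/
theorem integral_abs_sq_le_mul_of_sq_le_mul {a b g : ℝ → ℝ} (ha : Continuous a)
    (hb : Continuous b) (hg : Continuous g) (ha0 : ∀ x, 0 ≤ a x) (hb0 : ∀ x, 0 ≤ b x)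
    (h : ∀ x, g x ^ 2 ≤ a x * b x) :
    (∫ x in (0 : ℝ)..1, |g x|) ^ 2 ≤ (∫ x in (0 : ℝ)..1, a x) * ∫ x in (0 : ℝ)..1, b x := by
  have hpoly : ∀ t : ℝ, 0 ≤ (∫ x in (0 : ℝ)..1, a x) * (t * t)
      + (-2 * ∫ x in (0 : ℝ)..1, |g x|) * t + ∫ x in (0 : ℝ)..1, b x := by
    intro t
    have hint : (∫ x in (0 : ℝ)..1, a x) * (t * t) + (-2 * ∫ x in (0 : ℝ)..1, |g x|) * t
        + (∫ x in (0 : ℝ)..1, b x)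
        = ∫ x in (0 : ℝ)..1, (a x * (t * t) + (-2 * |g x|) * t + b x) := by
      rw [intervalIntegral.integral_add, intervalIntegral.integral_add,
        intervalIntegral.integral_mul_const, intervalIntegral.integral_mul_const,
        intervalIntegral.integral_const_mul]
      all_goals exact Continuous.intervalIntegrable (by fun_prop) _ _
    rw [hint]
    refine integral_nonneg zero_le_one fun x _ => ?_
    have hdisc : (2 * (|g x| * |t|)) ^ 2 ≤ (a x * (t * t) + b x) ^ 2 := by
      have h1 : |g x| ^ 2 * |t| ^ 2 ≤ a x * b x * t ^ 2 := by
        rw [sq_abs, sq_abs]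
        exact mul_le_mul_of_nonneg_right (h x) (sq_nonneg t)
      nlinarith [sq_nonneg (a x * (t * t) - b x)]
    have hle := le_of_sq_le_sq hdisc
      (add_nonneg (mul_nonneg (ha0 x) (mul_self_nonneg t)) (hb0 x))
    nlinarith [mul_le_mul_of_nonneg_left (le_abs_self t) (abs_nonneg (g x))]
  have := discrim_le_zero hpoly
  unfold discrim at this
  linarith

namespace T2Flow

theorem contDiff_slice_right {f : ℝ → ℝ → ℝ} (hf : ContDiff ℝ (⊤ : ℕ∞) (Function.uncurry f))
    (τ : ℝ) : ContDiff ℝ 1 (f τ) :=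
  (hf.comp (contDiff_prodMk_right τ)).of_le (mod_cast le_top)

theorem continuous_deriv_slice_right {f : ℝ → ℝ → ℝ}
    (hf : ContDiff ℝ (⊤ : ℕ∞) (Function.uncurry f)) (τ : ℝ) :
    Continuous fun θ => deriv (fun x => f τ x) θ :=
  (contDiff_slice_right hf τ).continuous_deriv le_rfl

theorem continuous_deriv_slice_left {f : ℝ → ℝ → ℝ}
    (hf : ContDiff ℝ (⊤ : ℕ∞) (Function.uncurry f)) (τ : ℝ) :
    Continuous fun θ => deriv (fun s => f s θ) τ := by
  have hfderiv : ∀ θ, deriv (fun s => f s θ) τ = fderiv ℝ (Function.uncurry f) (τ, θ) (1, 0) :=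
    fun θ => ((hf.differentiable (by simp) (τ, θ)).hasFDerivAt.comp_hasDerivAt
      (f := fun s => (s, θ)) τ ((hasDerivAt_id' τ).prodMk (hasDerivAt_const τ θ))).deriv
  simp_rw [hfderiv]
  have := hf.continuous_fderiv (by simp)
  fun_prop

theorem continuous_J (F : T2Flow) (τ : ℝ) : Continuous (F.J τ) := by
  have hVτ : Continuous (F.Vτ τ) := continuous_deriv_slice_left F.smooth_V τ
  have hVθ : Continuous (F.Vθ τ) := continuous_deriv_slice_right F.smooth_V τ
  have hQτ : Continuous (F.Qτ τ) := continuous_deriv_slice_left F.smooth_Q τ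
  have hQθ : Continuous (F.Qθ τ) := continuous_deriv_slice_right F.smooth_Q τ
  have hV : Continuous (F.V τ) := (contDiff_slice_right F.smooth_V τ).continuous
  have hρ : Continuous (F.ρ τ) := (contDiff_slice_right F.smooth_ρ τ).continuous
  unfold J
  fun_prop

theorem J_nonneg (F : T2Flow) (τ θ : ℝ) : 0 ≤ F.J τ θ := by
  unfold J
  positivity

theorem sq_Vθ_le (F : T2Flow) (τ θ : ℝ) :
    F.Vθ τ θ ^ 2 ≤ exp (F.ρ τ θ) * (2 * (exp (F.ρ τ θ - 2 * τ) * F.J τ θ)) := by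
  have hJ : exp (2 * (τ - F.ρ τ θ)) * F.Vθ τ θ ^ 2 ≤ 2 * F.J τ θ := by
    have h1 := sq_nonneg (F.Vτ τ θ)
    have h2 : 0 ≤ exp (2 * (F.V τ θ - τ))
        * (F.Qτ τ θ ^ 2 + exp (2 * (τ - F.ρ τ θ)) * F.Qθ τ θ ^ 2) := by positivity
    unfold J
    linarith
  have hexp : exp (F.ρ τ θ) * exp (F.ρ τ θ - 2 * τ) * exp (2 * (τ - F.ρ τ θ)) = 1 := by
    rw [← exp_add, ← exp_add, exp_eq_one_iff]
    ring
  calc F.Vθ τ θ ^ 2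
      = exp (F.ρ τ θ) * exp (F.ρ τ θ - 2 * τ)
          * (exp (2 * (τ - F.ρ τ θ)) * F.Vθ τ θ ^ 2) := by
        rw [← mul_assoc, hexp, one_mul]
    _ ≤ exp (F.ρ τ θ) * exp (F.ρ τ θ - 2 * τ) * (2 * F.J τ θ) := by gcongr
    _ = _ := by ring

theorem integral_abs_Vθ_sq_le (F : T2Flow) (τ : ℝ) :
    (∫ θ in (0 : ℝ)..1, |F.Vθ τ θ|) ^ 2 ≤ 2 * (F.Pi τ * F.E τ) := by
  have hρ : Continuous (F.ρ τ) := (contDiff_slice_right F.smooth_ρ τ).continuous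
  have hJ := F.continuous_J τ
  have hVθ : Continuous (F.Vθ τ) := continuous_deriv_slice_right F.smooth_V τ
  have h := integral_abs_sq_le_mul_of_sq_le_mul (a := fun θ => exp (F.ρ τ θ))
    (b := fun θ => 2 * (exp (F.ρ τ θ - 2 * τ) * F.J τ θ))
    (by fun_prop) (by fun_prop) hVθ (fun θ => (exp_pos _).le)
    (fun θ => mul_nonneg zero_le_two (mul_nonneg (exp_pos _).le (F.J_nonneg τ θ)))
    (F.sq_Vθ_le τ)
  rw [intervalIntegral.integral_const_mul] at h
  unfold Pi E
  linarith

end T2Flow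

/-- Along any T²-symmetric Einstein flow, `sup_θ |V − ⟨V⟩| ≲ (Π E)^{1/2}`, with a
constant independent of the solution and of `τ`. -/
theorem sup_V_minus_mean_bound :
    ∃ C : ℝ, 0 < C ∧ ∀ (F : T2Flow), F.IsEinsteinFlow →
      ∀ τ θ : ℝ, |F.V τ θ - circleMean (F.V τ)| ≤ C * Real.sqrt (F.Pi τ * F.E τ) := by
  refine ⟨√2, by positivity, fun F _ τ θ => ?_⟩
  rw [← Real.sqrt_mul zero_le_two]
  exact (abs_sub_circleMean_le_integral_abs_deriv (T2Flow.contDiff_slice_right F.smooth_V τ)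
    (F.periodic_V τ) θ).trans (Real.le_sqrt_of_sq_le (F.integral_abs_Vθ_sq_le τ))
end
end
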